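/- Let σ ∈ C¹([0,∞)) be such that σ'(r)/r is negative, bounded below, and monotone increasing for r > 0, and ∫₀^∞ r^{d+1} σ(r) dr < ∞, with d ≥ 2 and V > 0. Define ϱ(z) = ∫₀^∞ r^{d+1} σ(√(r² + 2rVz + V²)) dr for |z| ≤ 1. Then ϱ is continuously differentiable on [−1,1], ϱ'(z) = ∫₀^∞ r^{d+2} V · σ'(√(r² + 2rVz + V²))/√(r² + 2rVz + V²) dr is negative and monotone non-decreasing in z; in particular, for z > 0, ϱ'(z) > ϱ'(−z). -/

import Mathlib

open MeasureTheory Real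

/-- `σ` is antitone on `[0,∞)`. -/
lemma aux_anti (σ : ℝ → ℝ) (hσ : ContDiff ℝ 1 σ)
    (hneg : ∀ r > (0:ℝ), deriv σ r / r < 0) : AntitoneOn σ (Set.Ici 0) := by
  apply antitoneOn_of_deriv_nonpos (convex_Ici 0) hσ.continuous.continuousOn
    (hσ.differentiable (by norm_num)).differentiableOn
  intro x hx
  rw [interior_Ici] at hx
  have h := hneg x hx
  have hx' : (0:ℝ) < x := hx
  rw [div_neg_iff] at h
  rcases h with h | h
  · linarith [h.2]
  · exact h.1.le

lemma aux_nonneg (d : ℕ) (σ : ℝ → ℝ) (hanti : AntitoneOn σ (Set.Ici 0))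
    (hint : IntegrableOn (fun r => r ^ (d + 1) * σ r) (Set.Ioi 0)) :
    ∀ r, 0 ≤ r → 0 ≤ σ r := by
  intro r hr
  by_contra! hlt
  have h1 : IntegrableOn (fun r => r ^ (d + 1) * σ r) (Set.Ioi (max r 1)) :=
    hint.mono_set (fun x hx => by
      have : max r 1 < x := hx
      have := le_max_right r 1
      show (0:ℝ) < x
      linarith)
  have h2 : IntegrableOn (fun _ : ℝ => σ r) (Set.Ioi (max r 1)) := by
    refine Integrable.mono' h1.norm (by fun_prop) ?_
    filter_upwards [ae_restrict_mem measurableSet_Ioi] with x hx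
    have hx' : max r 1 < x := hx
    have a1 := le_max_right r 1
    have a2 := le_max_left r 1
    have a3 : σ x ≤ σ r := hanti hr (show (0:ℝ) ≤ x by linarith) (by linarith)
    rw [norm_mul, Real.norm_of_nonpos hlt.le, Real.norm_of_nonpos (by linarith : σ x ≤ 0),
      norm_pow, Real.norm_of_nonneg (by linarith)]
    have a4 : (1:ℝ) ≤ x ^ (d+1) := one_le_pow₀ (by linarith)
    nlinarith
  rw [integrableOn_const_iff] at h2
  simp at h2
  exact hlt.ne h2

lemma aux_int (d : ℕ) (σ : ℝ → ℝ) (hσ : ContDiff ℝ 1 σ) (hanti : AntitoneOn σ (Set.Ici 0))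
    (hd0 : ∀ r > (0:ℝ), deriv σ r ≤ 0)
    (hint : IntegrableOn (fun r => r ^ (d + 1) * σ r) (Set.Ioi 0)) :
    IntegrableOn (fun r => r ^ (d + 2) * deriv σ r) (Set.Ioi 0) := by
  have hnn := aux_nonneg d σ hanti hint
  have hdc : Continuous (deriv σ) := hσ.continuous_deriv (by norm_num)
  have hsc := hσ.continuous
  refine integrableOn_Ioi_of_intervalIntegral_norm_bounded
    ((d+2) * ∫ r in Set.Ioi (0:ℝ), r ^ (d + 1) * σ r) 0 (l := Filter.atTop) (b := id)
    (fun i => ?_) Filter.tendsto_id ?_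
  · exact ((by fun_prop : Continuous (fun r => r ^ (d + 2) * deriv σ r)).integrableOn_Icc).mono_set
      Set.Ioc_subset_Icc_self
  filter_upwards [Filter.eventually_ge_atTop 0] with R hR
  simp only [id]
  have e1 : ∫ x in (0:ℝ)..R, ‖x ^ (d+2) * deriv σ x‖ = - ∫ x in (0:ℝ)..R, x ^ (d+2) * deriv σ x := by
    rw [← intervalIntegral.integral_neg]
    apply intervalIntegral.integral_congr_ae
    filter_upwards with x hx
    rw [Set.uIoc_of_le hR] at hx
    rw [Real.norm_of_nonpos]
    exact mul_nonpos_of_nonneg_of_nonpos (pow_nonneg hx.1.le _) (hd0 x hx.1)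
  have e2 : ∫ x in (0:ℝ)..R, x ^ (d+2) * deriv σ x
      = R ^ (d+2) * σ R - 0 ^ (d+2) * σ 0 - ∫ x in (0:ℝ)..R, ((d+2 : ℕ) * x ^ (d+1)) * σ x := by
    apply intervalIntegral.integral_mul_deriv_eq_deriv_mul
    · intro x _
      simpa using hasDerivAt_pow (d+2) x
    · intro x _
      exact ((hσ.differentiable (by norm_num)) x).hasDerivAt
    · exact (by fun_prop : Continuous (fun x : ℝ => ((d+2 : ℕ) * x ^ (d+1)))).intervalIntegrable _ _
    · exact hdc.intervalIntegrable _ _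
  have e3 : ∫ x in (0:ℝ)..R, ((d+2 : ℕ) * x ^ (d+1)) * σ x
      = (d+2) * ∫ x in (0:ℝ)..R, x ^ (d+1) * σ x := by
    rw [← intervalIntegral.integral_const_mul]
    congr 1
    ext x
    push_cast
    ring
  have e4 : ∫ x in (0:ℝ)..R, x ^ (d+1) * σ x ≤ ∫ r in Set.Ioi (0:ℝ), r ^ (d + 1) * σ r := by
    rw [intervalIntegral.integral_of_le hR]
    apply setIntegral_mono_set hint
    · filter_upwards [ae_restrict_mem measurableSet_Ioi] with x hx
      exact mul_nonneg (pow_nonneg (le_of_lt hx) _) (hnn x (le_of_lt hx))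
    · exact Filter.Eventually.of_forall Set.Ioc_subset_Ioi_self
  have e5 : 0 ≤ R ^ (d+2) * σ R := mul_nonneg (pow_nonneg hR _) (hnn R hR)
  rw [e1, e2, e3]
  have : (0:ℝ) ^ (d+2) = 0 := by simp
  rw [this]
  have e6 := mul_le_mul_of_nonneg_left e4 (by positivity : (0:ℝ) ≤ d + 2)
  linarith

/-- an integrable dominating function -/
lemma aux_bound (n : ℕ) (C V : ℝ) (f : ℝ → ℝ)
    (hf : IntegrableOn (fun r => r ^ n * f r) (Set.Ioi 0)) :
    IntegrableOn (fun r => (Set.Icc 0 (2*V)).indicator (fun r => r ^ n * C) r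
      + 2 ^ n * ((r * (1/2)) ^ n * f (r * (1/2)))) (Set.Ioi 0) := by
  apply Integrable.add
  · apply Integrable.integrableOn
    rw [integrable_indicator_iff measurableSet_Icc]
    exact (by fun_prop : Continuous (fun r : ℝ => r ^ n * C)).integrableOn_Icc
  · apply Integrable.const_mul
    have := (integrableOn_Ioi_comp_mul_right_iff (fun r => r ^ n * f r) 0
      (by norm_num : (0:ℝ) < 1/2)).2 (by simpa using hf)
    exact this

lemma aux_q (V r z : ℝ) (hV : 0 < V) (hr : 0 < r) (hz : z ∈ Set.Icc (-1:ℝ) 1) :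
    |r - V| ≤ Real.sqrt (r ^ 2 + 2 * r * V * z + V ^ 2) := by
  apply Real.abs_le_sqrt
  have := mul_nonneg (mul_pos hr hV).le (by linarith [hz.1] : 0 ≤ z + 1)
  nlinarith

lemma aux_const (G : ℝ → ℝ) (a δ : ℝ) (hδ : 0 < δ) (hm : MonotoneOn G (Set.Ici a))
    (h : ∀ u, a ≤ u → G u = G (u + δ)) : ∀ u, a ≤ u → G u = G a := by
  have h1 : ∀ n : ℕ, G (a + n * δ) = G a := by
    intro n
    induction n with
    | zero => simp
    | succ k ih =>
      rw [← ih, h (a + k * δ) (by have : 0 ≤ k * δ := by positivity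
                                  linarith)]
      push_cast
      ring_nf
  intro u hu
  obtain ⟨n, hn⟩ := exists_nat_gt ((u - a) / δ)
  rw [div_lt_iff₀ hδ] at hn
  apply le_antisymm
  · rw [← h1 n]
    exact hm hu (show a ≤ a + n * δ by linarith) (by linarith)
  · exact hm (show a ≤ a from le_rfl) hu hu

theorem stmt_12 (d : ℕ) (hd : 2 ≤ d) (V : ℝ) (hV : 0 < V) (σ : ℝ → ℝ)
    (hσ : ContDiff ℝ 1 σ)
    (hneg : ∀ r > (0:ℝ), deriv σ r / r < 0)
    (hbdd : ∃ m : ℝ, ∀ r > (0:ℝ), m ≤ deriv σ r / r)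
    (hmono : MonotoneOn (fun r => deriv σ r / r) (Set.Ioi 0))
    (hint : IntegrableOn (fun r => r ^ (d + 1) * σ r) (Set.Ioi 0)) :
    let ϱ : ℝ → ℝ := fun z =>
      ∫ r in Set.Ioi (0:ℝ), r ^ (d + 1) * σ (Real.sqrt (r ^ 2 + 2 * r * V * z + V ^ 2))
    let ϱ' : ℝ → ℝ := fun z =>
      ∫ r in Set.Ioi (0:ℝ), r ^ (d + 2) * V *
        deriv σ (Real.sqrt (r ^ 2 + 2 * r * V * z + V ^ 2)) /
          Real.sqrt (r ^ 2 + 2 * r * V * z + V ^ 2)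
    (∀ z ∈ Set.Icc (-1:ℝ) 1, HasDerivWithinAt ϱ (ϱ' z) (Set.Icc (-1) 1) z) ∧
    ContinuousOn ϱ' (Set.Icc (-1) 1) ∧
    (∀ z ∈ Set.Icc (-1:ℝ) 1, ϱ' z < 0) ∧
    MonotoneOn ϱ' (Set.Icc (-1) 1) ∧
    (∀ z ∈ Set.Ioc (0:ℝ) 1, ϱ' (-z) < ϱ' z) := by
  intro ϱ ϱ'
  have hanti := aux_anti σ hσ hneg
  have hnn := aux_nonneg d σ hanti hint
  have hdneg : ∀ r > (0:ℝ), deriv σ r < 0 := fun r hr => by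
    have h := hneg r hr
    rcases div_neg_iff.1 h with h | h
    · linarith [h.2]
    · exact h.1
  have hint' := aux_int d σ hσ hanti (fun r hr => (hdneg r hr).le) hint
  have hdc : Continuous (deriv σ) := hσ.continuous_deriv (by norm_num)
  have hdm : Measurable (deriv σ) := hdc.measurable
  have hsc := hσ.continuous
  have hsm := hsc.measurable
  obtain ⟨m, hm⟩ := hbdd
  let s : ℝ → ℝ → ℝ := fun z r => Real.sqrt (r ^ 2 + 2 * r * V * z + V ^ 2)
  let F : ℝ → ℝ → ℝ := fun z r => r ^ (d + 1) * σ (s z r)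
  let F' : ℝ → ℝ → ℝ := fun z r => r ^ (d + 2) * V * deriv σ (s z r) / s z r
  have hF'eq : ∀ z r, F' z r = r ^ (d+2) * V * (deriv σ (s z r) / s z r) :=
    fun z r => mul_div_assoc _ _ _
  have hsmeas : ∀ z, Measurable (s z) := fun z => by
    simp only [s]; fun_prop
  have hscz : ∀ r, Continuous (fun z => s z r) := fun r => by
    simp only [s]; fun_prop
  have hscr : ∀ z, Continuous (s z) := fun z => by
    simp only [s]; fun_prop
  have hFm : ∀ z, Measurable (F z) := fun z =>
    (by fun_prop : Measurable (fun r : ℝ => r ^ (d+1))).mul (hsm.comp (hsmeas z))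
  have hF'm : ∀ z, Measurable (F' z) := fun z =>
    ((by fun_prop : Measurable (fun r : ℝ => r ^ (d+2) * V)).mul (hdm.comp (hsmeas z))).div
      (hsmeas z)
  have hspos : ∀ z ∈ Set.Icc (-1:ℝ) 1, ∀ r, 0 < r → r ≠ V → 0 < s z r := by
    intro z hz r hr hrV
    exact lt_of_lt_of_le (abs_pos.2 (sub_ne_zero.2 hrV)) (aux_q V r z hV hr hz)
  have hshalf : ∀ z ∈ Set.Icc (-1:ℝ) 1, ∀ r, 2 * V < r → r * (1/2) ≤ s z r := by
    intro z hz r hr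
    refine le_trans ?_ (aux_q V r z hV (by linarith) hz)
    refine le_trans ?_ (le_abs_self _)
    linarith
  -- good set
  have hae : ∀ᵐ r ∂(volume.restrict (Set.Ioi (0:ℝ))), 0 < r ∧ r ≠ V := by
    filter_upwards [ae_restrict_mem measurableSet_Ioi,
      ae_restrict_of_ae (Measure.ae_ne volume V)] with r h1 h2
    exact ⟨h1, h2⟩
  -- bounds
  let B : ℝ → ℝ := fun r => (Set.Icc 0 (2*V)).indicator (fun r => r ^ (d+1) * σ 0) r
      + 2 ^ (d+1) * ((r * (1/2)) ^ (d+1) * σ (r * (1/2)))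
  let B' : ℝ → ℝ := fun r => (Set.Icc 0 (2*V)).indicator (fun r => r ^ (d+2) * (V * (-m))) r
      + 2 ^ (d+2) * ((r * (1/2)) ^ (d+2) * (- deriv σ (r * (1/2))))
  have hB : IntegrableOn B (Set.Ioi 0) := aux_bound (d+1) (σ 0) V σ hint
  have hB' : IntegrableOn B' (Set.Ioi 0) := aux_bound (d+2) (V * (-m)) V (fun r => - deriv σ r)
    (by simpa using hint'.neg)
  have hFB : ∀ z ∈ Set.Icc (-1:ℝ) 1, ∀ r, 0 < r → ‖F z r‖ ≤ B r := by
    intro z hz r hr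
    have hs0 : 0 ≤ s z r := Real.sqrt_nonneg _
    have h0 : 0 ≤ F z r := mul_nonneg (pow_nonneg hr.le _) (hnn _ hs0)
    rw [Real.norm_of_nonneg h0]
    have h2 : (2:ℝ) ^ (d+1) * ((r * (1/2)) ^ (d+1) * σ (r * (1/2)))
        = r ^ (d+1) * σ (r * (1/2)) := by
      rw [← mul_assoc, ← mul_pow]; ring_nf
    simp only [B, h2]
    by_cases hc : r ≤ 2 * V
    · rw [Set.indicator_of_mem (show r ∈ Set.Icc 0 (2*V) from ⟨hr.le, hc⟩)]
      have h3 : F z r ≤ r ^ (d+1) * σ 0 :=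
        mul_le_mul_of_nonneg_left (hanti (show (0:ℝ) ≤ 0 from le_rfl) hs0 hs0) (pow_nonneg hr.le _)
      have h4 : 0 ≤ r ^ (d+1) * σ (r * (1/2)) :=
        mul_nonneg (pow_nonneg hr.le _) (hnn _ (by positivity))
      linarith
    · rw [Set.indicator_of_notMem (fun h => hc h.2), zero_add]
      exact mul_le_mul_of_nonneg_left (hanti (show (0:ℝ) ≤ r * (1/2) by positivity) hs0
        (hshalf z hz r (by linarith))) (pow_nonneg hr.le _)
  have hF'neg : ∀ z ∈ Set.Icc (-1:ℝ) 1, ∀ r, 0 < r → r ≠ V → F' z r < 0 := by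
    intro z hz r hr hrV
    rw [hF'eq]
    exact mul_neg_of_pos_of_neg (by positivity) (hneg _ (hspos z hz r hr hrV))
  have hF'B : ∀ z ∈ Set.Icc (-1:ℝ) 1, ∀ r, 0 < r → r ≠ V → ‖F' z r‖ ≤ B' r := by
    intro z hz r hr hrV
    have hs := hspos z hz r hr hrV
    rw [Real.norm_of_nonpos (hF'neg z hz r hr hrV).le, hF'eq]
    have h2 : (2:ℝ) ^ (d+2) * ((r * (1/2)) ^ (d+2) * (- deriv σ (r * (1/2))))
        = r ^ (d+2) * (- deriv σ (r * (1/2))) := by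
      rw [← mul_assoc, ← mul_pow]; ring_nf
    have hp : (0:ℝ) < r ^ (d+2) := pow_pos hr _
    have hdn := hdneg (r * (1/2)) (by positivity)
    simp only [B', h2]
    by_cases hc : r ≤ 2 * V
    · rw [Set.indicator_of_mem (show r ∈ Set.Icc 0 (2*V) from ⟨hr.le, hc⟩)]
      have h3 := mul_le_mul_of_nonneg_left (hm _ hs) (mul_pos hp hV).le
      have h4 : 0 ≤ r ^ (d+2) * (- deriv σ (r * (1/2))) :=
        mul_nonneg hp.le (by linarith)
      linarith
    · rw [Set.indicator_of_notMem (fun h => hc h.2), zero_add]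
      push Not at hc
      have h3 : deriv σ (r * (1/2)) / (r * (1/2)) ≤ deriv σ (s z r) / s z r :=
        hmono (show (0:ℝ) < r * (1/2) by positivity) hs (hshalf z hz r hc)
      have h4 : deriv σ (r * (1/2)) ≤ V * (deriv σ (r * (1/2)) / (r * (1/2))) := by
        have : V / (r * (1/2)) ≤ 1 := by
          rw [div_le_one (by positivity)]; linarith
        have e : V * (deriv σ (r * (1/2)) / (r * (1/2))) = (V / (r * (1/2))) * deriv σ (r * (1/2)) := by
          ring
        rw [e]
        nlinarith
      have h5 := mul_le_mul_of_nonneg_left h3 hV.le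
      have h6 := mul_le_mul_of_nonneg_left (h4.trans h5) hp.le
      linarith
  have hFint : ∀ z ∈ Set.Icc (-1:ℝ) 1, IntegrableOn (F z) (Set.Ioi 0) := by
    intro z hz
    refine Integrable.mono' hB (hFm z).aestronglyMeasurable ?_
    filter_upwards [hae] with r hr using hFB z hz r hr.1
  have hF'int : ∀ z ∈ Set.Icc (-1:ℝ) 1, IntegrableOn (F' z) (Set.Ioi 0) := by
    intro z hz
    refine Integrable.mono' hB' (hF'm z).aestronglyMeasurable ?_
    filter_upwards [hae] with r hr using hF'B z hz r hr.1 hr.2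
  have hderiv : ∀ z ∈ Set.Icc (-1:ℝ) 1, ∀ r, 0 < r → r ≠ V →
      HasDerivAt (fun z => F z r) (F' z r) z := by
    intro z hz r hr hrV
    have hs := hspos z hz r hr hrV
    have hq : r ^ 2 + 2 * r * V * z + V ^ 2 ≠ 0 := (Real.sqrt_pos.1 hs).ne'
    have d1 : HasDerivAt (fun z => r ^ 2 + 2 * r * V * z + V ^ 2) (2 * r * V) z := by
      simpa using (((hasDerivAt_id z).const_mul (2 * r * V)).const_add (r^2)).add_const (V^2)
    have d2 := d1.sqrt hq
    have d3 : HasDerivAt σ (deriv σ (s z r)) (s z r) :=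
      ((hσ.differentiable (by norm_num)) _).hasDerivAt
    have d4 := (HasDerivAt.comp z d3 d2).const_mul (r ^ (d+1))
    refine d4.congr_deriv ?_
    change r ^ (d+1) * (deriv σ (s z r) * (2 * r * V / (2 * s z r))) = F' z r
    simp only [F']
    field_simp
    ring
  have hmonoF' : ∀ z ∈ Set.Icc (-1:ℝ) 1, ∀ w ∈ Set.Icc (-1:ℝ) 1, z ≤ w →
      ∀ r, 0 < r → r ≠ V → F' z r ≤ F' w r := by
    intro z hz w hw hzw r hr hrV
    rw [hF'eq, hF'eq]
    refine mul_le_mul_of_nonneg_left (hmono (hspos z hz r hr hrV) (hspos w hw r hr hrV) ?_)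
      (by positivity)
    apply Real.sqrt_le_sqrt
    have := mul_le_mul_of_nonneg_left hzw (by positivity : 0 ≤ 2 * r * V)
    linarith
  refine ⟨?_, ?_, ?_, ?_, ?_⟩
  · intro z hz
    rw [hasDerivWithinAt_iff_tendsto_slope]
    have key : Filter.Tendsto (fun w => ∫ r in Set.Ioi (0:ℝ), slope (fun z => F z r) z w)
        (nhdsWithin z (Set.Icc (-1) 1 \ {z})) (nhds (∫ r in Set.Ioi (0:ℝ), F' z r)) := by
      apply tendsto_integral_filter_of_dominated_convergence B'
      · filter_upwards with w
        simp only [slope_def_field]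
        exact (((hFm w).sub (hFm z)).div_const _).aestronglyMeasurable
      · filter_upwards [self_mem_nhdsWithin] with w hw
        filter_upwards [hae] with r hr
        have hb := Convex.norm_image_sub_le_of_norm_hasDerivWithin_le
          (f := fun z => F z r) (f' := fun z => F' z r) (C := B' r) (s := Set.Icc (-1:ℝ) 1)
          (x := z) (y := w)
          (fun x hx => (hderiv x hx r hr.1 hr.2).hasDerivWithinAt)
          (fun x hx => hF'B x hx r hr.1 hr.2) (convex_Icc _ _) hz hw.1
        rw [slope_def_field, norm_div, div_le_iff₀ (norm_pos_iff.2 (sub_ne_zero.2 hw.2))]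
        exact hb
      · exact hB'
      · filter_upwards [hae] with r hr
        have := (hderiv z hz r hr.1 hr.2).hasDerivWithinAt (s := Set.Icc (-1:ℝ) 1)
        rwa [hasDerivWithinAt_iff_tendsto_slope] at this
    refine key.congr' ?_
    filter_upwards [self_mem_nhdsWithin] with w hw
    simp only [slope_def_field]
    rw [integral_div, integral_sub (hFint w hw.1) (hFint z hz)]
  · apply continuousOn_of_dominated (F := F') (bound := B')
    · intro z _
      exact (hF'm z).aestronglyMeasurable
    · intro z hz
      filter_upwards [hae] with r hr using hF'B z hz r hr.1 hr.2
    · exact hB'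
    · filter_upwards [hae] with r hr
      refine ContinuousOn.div ?_ (hscz r).continuousOn (fun z hz => (hspos z hz r hr.1 hr.2).ne')
      exact (continuous_const.mul (hdc.comp (hscz r))).continuousOn
  · intro z hz
    have hle : ∫ r in Set.Ioi (0:ℝ), F' z r ≤ 0 := by
      apply integral_nonpos_of_ae
      filter_upwards [hae] with r hr using (hF'neg z hz r hr.1 hr.2).le
    refine lt_of_le_of_ne hle (fun h0 => ?_)
    have h1 : ∫ r in Set.Ioi (0:ℝ), (- F' z) r = 0 := by
      change ∫ r in Set.Ioi (0:ℝ), - F' z r = 0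
      rw [integral_neg, neg_eq_zero]
      exact h0
    rw [integral_eq_zero_iff_of_nonneg_ae ?_ (hF'int z hz).neg] at h1
    · have h2 : ∀ᵐ r ∂(volume.restrict (Set.Ioi (0:ℝ))), False := by
        filter_upwards [hae, h1] with r hr h
        have := hF'neg z hz r hr.1 hr.2
        have h' : -(F' z r) = 0 := h
        linarith
      rw [Filter.eventually_false_iff_eq_bot, ae_eq_bot, Measure.restrict_eq_zero,
        Real.volume_Ioi] at h2
      exact ENNReal.top_ne_zero h2
    · filter_upwards [hae] with r hr
      have := hF'neg z hz r hr.1 hr.2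
      change 0 ≤ -(F' z r)
      linarith
  · intro z hz w hw hzw
    apply integral_mono_ae (hF'int z hz) (hF'int w hw)
    filter_upwards [hae] with r hr using hmonoF' z hz w hw hzw r hr.1 hr.2
  · intro z hz
    have hz1 : z ∈ Set.Icc (-1:ℝ) 1 := ⟨by linarith [hz.1], hz.2⟩
    have hz2 : -z ∈ Set.Icc (-1:ℝ) 1 := ⟨by linarith [hz.2], by linarith [hz.1]⟩
    have hz0 : 0 < z := hz.1
    have hmz : ∀ᵐ r ∂(volume.restrict (Set.Ioi (0:ℝ))), F' (-z) r ≤ F' z r := by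
      filter_upwards [hae] with r hr using
        hmonoF' (-z) hz2 z hz1 (by linarith) r hr.1 hr.2
    have hle : ∫ r in Set.Ioi (0:ℝ), F' (-z) r ≤ ∫ r in Set.Ioi (0:ℝ), F' z r :=
      integral_mono_ae (hF'int _ hz2) (hF'int z hz1) hmz
    refine lt_of_le_of_ne hle (fun h0 => ?_)
    have h1 := (integral_eq_iff_of_ae_le (hF'int _ hz2) (hF'int z hz1) hmz).1 h0
    have h2 : F' (-z) =ᵐ[volume.restrict (Set.Ioi V)] F' z :=
      ae_restrict_of_ae_restrict_of_subset (Set.Ioi_subset_Ioi hV.le) h1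
    have hcF' : ∀ w ∈ Set.Icc (-1:ℝ) 1, ContinuousOn (F' w) (Set.Ioi V) := by
      intro w hw
      refine ContinuousOn.div ?_ (hscr w).continuousOn
        (fun r hr => (hspos w hw r (hV.trans hr) (ne_of_gt hr)).ne')
      exact ((by fun_prop : Continuous (fun r : ℝ => r ^ (d+2) * V)).mul
        (hdc.comp (hscr w))).continuousOn
    have h3 := Measure.eqOn_open_of_ae_eq h2 isOpen_Ioi (hcF' _ hz2) (hcF' _ hz1)
    let G : ℝ → ℝ := fun u => deriv σ (Real.sqrt u) / Real.sqrt u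
    have hG : MonotoneOn G (Set.Ioi 0) := by
      intro a ha b hb hab
      exact hmono (Real.sqrt_pos.2 ha) (Real.sqrt_pos.2 hb) (Real.sqrt_le_sqrt hab)
    have h4 : ∀ r, V < r → G (r ^ 2 + V ^ 2 - 2 * r * V * z) = G (r ^ 2 + V ^ 2 + 2 * r * V * z) := by
      intro r hr
      have h := h3 hr
      rw [hF'eq, hF'eq] at h
      have hr0 : 0 < r := hV.trans hr
      have h' := mul_left_cancel₀ (by positivity : r ^ (d+2) * V ≠ 0) h
      have e1 : r ^ 2 + V ^ 2 - 2 * r * V * z = r ^ 2 + 2 * r * V * (-z) + V ^ 2 := by ring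
      have e2 : r ^ 2 + V ^ 2 + 2 * r * V * z = r ^ 2 + 2 * r * V * z + V ^ 2 := by ring
      rw [e1, e2]
      exact h'
    have hδ : 0 < 2 * V ^ 2 * z := by positivity
    have h5 : ∀ u, 5 * V ^ 2 ≤ u → G u = G (u + 2 * V ^ 2 * z) := by
      intro u hu
      have hV2 : 0 < V ^ 2 := by positivity
      set r := Real.sqrt (u - V ^ 2) with hrdef
      have hr2 : r ^ 2 = u - V ^ 2 := Real.sq_sqrt (by linarith)
      have hr : V < r := Real.lt_sqrt_of_sq_lt (by linarith)
      have h := h4 r hr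
      have hrp : 0 < r := hV.trans hr
      have hrz : r * V * z ≤ r * V := mul_le_of_le_one_right (by positivity) hz.2
      have hpos : 0 < r ^ 2 + V ^ 2 - 2 * r * V * z := by nlinarith [sq_pos_of_pos (sub_pos.2 hr)]
      have hrV : 2 * V ^ 2 * z ≤ 2 * r * V * z := by
        have : V * V * z ≤ r * V * z := by gcongr
        nlinarith
      have hu0 : 0 < u := by linarith
      apply le_antisymm
      · exact hG hu0 (show 0 < u + 2 * V ^ 2 * z by linarith) (by linarith)
      · calc G (u + 2 * V ^ 2 * z) ≤ G (r ^ 2 + V ^ 2 + 2 * r * V * z) :=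
              hG (show 0 < u + 2 * V ^ 2 * z by linarith)
                (show 0 < r ^ 2 + V ^ 2 + 2 * r * V * z by positivity) (by linarith)
          _ = G (r ^ 2 + V ^ 2 - 2 * r * V * z) := h.symm
          _ ≤ G u := hG hpos hu0 (by linarith)
    have ha : 0 < 5 * V ^ 2 := by positivity
    have h6 := aux_const G (5 * V ^ 2) _ hδ
      (hG.mono (fun x hx => lt_of_lt_of_le ha hx)) h5
    have hGneg : G (5 * V ^ 2) < 0 := hneg _ (Real.sqrt_pos.2 ha)
    set c := G (5 * V ^ 2) with hc
    set t0 := Real.sqrt (5 * V ^ 2) with ht0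
    have ht0p : 0 < t0 := Real.sqrt_pos.2 ha
    have h7 : ∀ t, t0 ≤ t → deriv σ t ≤ c * t0 := by
      intro t ht
      have htp : 0 < t := ht0p.trans_le ht
      have h := h6 (t ^ 2) (by
        have := Real.sq_sqrt ha.le
        rw [← this, ← ht0]
        gcongr)
      simp only [G, Real.sqrt_sq htp.le] at h
      rw [div_eq_iff htp.ne'] at h
      rw [h]
      exact mul_le_mul_of_nonpos_left ht hGneg.le
    have hct : c * t0 < 0 := mul_neg_of_neg_of_pos hGneg ht0p
    have h8 : ∀ t, t0 ≤ t → σ t - σ t0 ≤ c * t0 * (t - t0) := by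
      intro t ht
      refine Convex.image_sub_le_mul_sub_of_deriv_le (convex_Ici t0) hsc.continuousOn
        (hσ.differentiable (by norm_num)).differentiableOn ?_ t0 Set.self_mem_Ici t ht ht
      intro x hx
      exact h7 x (interior_subset hx)
    have hs0 := hnn t0 ht0p.le
    have hT : t0 ≤ t0 + (σ t0 + 1) / (-(c * t0)) := by
      have : 0 ≤ (σ t0 + 1) / (-(c * t0)) := div_nonneg (by linarith) (by linarith)
      linarith
    have h9 := h8 _ hT
    have h10 := hnn _ (ht0p.le.trans hT)
    have e : c * t0 * (t0 + (σ t0 + 1) / (-(c * t0)) - t0) = -(σ t0 + 1) := by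
      have := hct.ne
      have h1 := hGneg.ne
      have h2 := ht0p.ne'
      generalize c * t0 = k at *
      field_simp
      ring
    rw [e] at h9
    linarith
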